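/- Let f : ℝ^d → ℝ be L-Lipschitz and ω ∼ N(0,I_d). Then Var(f(ω)) ≤ L². Consequently, for i.i.d. samples ω₁,…,ω_m, E[(E[f(ω)] − (1/m)∑_j f(ω_j))²] = Var(f(ω))/m ≤ L²/m. -/

import Mathlib

open MeasureTheory ProbabilityTheory

/-- The standard Gaussian measure `N(0, I_d)` on `ℝ^d`. -/
noncomputable def stdGaussian (d : ℕ) : Measure (EuclideanSpace ℝ (Fin d)) :=
  (Measure.pi fun _ : Fin d => gaussianReal 0 1).map
    (⇑(EuclideanSpace.equiv (Fin d) ℝ).symm)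


namespace GP
open Set Filter Topology

lemma hasDerivAt_pdf (x : ℝ) :
    HasDerivAt (fun x => -gaussianPDFReal 0 1 x) (x * gaussianPDFReal 0 1 x) x := by
  simp only [gaussianPDFReal_def]
  have h : HasDerivAt (fun x : ℝ => -(x - 0) ^ 2 / (2 * ((1 : NNReal) : ℝ))) (-x) x := by
    have := (((hasDerivAt_id x).sub_const 0).pow 2).neg.div_const (2 * ((1 : NNReal) : ℝ))
    refine HasDerivAt.congr_deriv this ?_
    simp; ring
  have h2 := (h.exp.const_mul ((√(2 * Real.pi * ((1 : NNReal) : ℝ)))⁻¹)).neg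
  refine HasDerivAt.congr_deriv h2 ?_
  ring

lemma tendsto_pdf : Tendsto (fun x => -gaussianPDFReal 0 1 x) atTop (𝓝 0) := by
  have h : Tendsto (fun x : ℝ => -(x - 0) ^ 2 / (2 * ((1 : NNReal) : ℝ))) atTop atBot := by
    have h1 : Tendsto (fun x : ℝ => x ^ 2) atTop atTop := tendsto_pow_atTop (by norm_num)
    have h2 := (tendsto_neg_atTop_atBot.comp h1).atBot_div_const (r := 2) (by norm_num)
    refine h2.congr fun x => ?_
    simp
  have h2 := ((Real.tendsto_exp_atBot.comp h).const_mul
    ((√(2 * Real.pi * ((1 : NNReal) : ℝ)))⁻¹)).neg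
  simp only [gaussianPDFReal_def]
  simpa using h2

noncomputable abbrev γ : Measure ℝ := gaussianReal 0 1

lemma integrable_id_γ : Integrable (fun x : ℝ => x) γ :=
  (memLp_id_gaussianReal (μ := 0) (v := 1) 1).integrable le_rfl

lemma int_Ici (t : ℝ) : ∫ x in Ici t, x ∂γ = gaussianPDFReal 0 1 t := by
  have hi : Integrable (fun x : ℝ => x * gaussianPDFReal 0 1 x) := by
    have h := integrable_id_γ
    rw [γ, gaussianReal_of_var_ne_zero _ one_ne_zero,
      integrable_withDensity_iff_integrable_smul' (measurable_gaussianPDF 0 1)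
        (ae_of_all _ fun x => gaussianPDF_lt_top)] at h
    simpa [toReal_gaussianPDF, mul_comm] using h
  have h1 := integral_Ioi_of_hasDerivAt_of_tendsto' (a := t) (fun x _ => hasDerivAt_pdf x)
    hi.integrableOn tendsto_pdf
  rw [← integral_indicator measurableSet_Ici, γ,
    integral_gaussianReal_eq_integral_smul one_ne_zero]
  have : (fun x => gaussianPDFReal 0 1 x • (Ici t).indicator (fun x => x) x)
      = (Ici t).indicator (fun x => x * gaussianPDFReal 0 1 x) := by
    ext x; by_cases hx : x ∈ Ici t <;> simp [hx, mul_comm]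
  rw [this, integral_indicator measurableSet_Ici, integral_Ici_eq_integral_Ioi, h1]
  simp

lemma int_Iio (t : ℝ) : ∫ x in Iio t, x ∂γ = -gaussianPDFReal 0 1 t := by
  have h := integral_add_compl (measurableSet_Ici (a := t)) integrable_id_γ
  rw [int_Ici, compl_Ici] at h
  have h2 : ∫ x, x ∂γ = 0 := integral_id_gaussianReal
  linarith

/-- the kernel -/
noncomputable def k (t x y : ℝ) : ℝ :=
  (Ici t).indicator (fun x => x) x * (Iio t).indicator (fun _ => 1) y
    - (Ici t).indicator (fun _ => 1) x * (Iio t).indicator (fun y => y) y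

lemma k_eq (t x y : ℝ) : k t x y = if y < t ∧ t ≤ x then x - y else 0 := by
  unfold k
  by_cases h1 : y < t <;> by_cases h2 : t ≤ x <;> simp [h1, h2]

lemma k_nonneg (t x y : ℝ) : 0 ≤ k t x y := by
  rw [k_eq]; split_ifs <;> grind

lemma meas_k : Measurable (fun p : ℝ × ℝ × ℝ => k p.1 p.2.1 p.2.2) := by
  simp only [k_eq]
  refine Measurable.ite ?_ (by fun_prop) (by fun_prop)
  have h1 : MeasurableSet {p : ℝ × ℝ × ℝ | p.2.2 < p.1} :=
    measurableSet_lt (by fun_prop) (by fun_prop)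
  have h2 : MeasurableSet {p : ℝ × ℝ × ℝ | p.1 ≤ p.2.1} :=
    measurableSet_le (by fun_prop) (by fun_prop)
  exact h1.inter h2

lemma lint_k (t : ℝ) : ∫⁻ p, ENNReal.ofReal (k t p.1 p.2) ∂(γ.prod γ) = gaussianPDF 0 1 t := by
  have i1 : Integrable ((Ici t).indicator (fun x : ℝ => x)) γ :=
    integrable_id_γ.indicator measurableSet_Ici
  have i2 : Integrable ((Iio t).indicator (fun x : ℝ => x)) γ :=
    integrable_id_γ.indicator measurableSet_Iio
  have i3 : Integrable ((Ici t).indicator (fun _ : ℝ => (1:ℝ))) γ :=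
    (integrable_const _).indicator measurableSet_Ici
  have i4 : Integrable ((Iio t).indicator (fun _ : ℝ => (1:ℝ))) γ :=
    (integrable_const _).indicator measurableSet_Iio
  have j1 := i1.mul_prod i4
  have j2 := i3.mul_prod i2
  have j : Integrable (fun p : ℝ × ℝ => k t p.1 p.2) (γ.prod γ) := j1.sub j2
  rw [← ofReal_integral_eq_lintegral_ofReal j (ae_of_all _ fun p => k_nonneg _ _ _), gaussianPDF]
  congr 1
  unfold k
  rw [integral_sub j1 j2, integral_prod_mul, integral_prod_mul,
    integral_indicator measurableSet_Ici, integral_indicator measurableSet_Ici,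
    integral_indicator measurableSet_Iio, integral_indicator measurableSet_Iio, int_Ici, int_Iio]
  have h : ∫ x in Ici t, (1:ℝ) ∂γ + ∫ x in Iio t, (1:ℝ) ∂γ = 1 := by
    rw [← compl_Ici, integral_add_compl measurableSet_Ici (integrable_const _)]; simp
  linear_combination gaussianPDFReal 0 1 t * h

lemma lint_k' (t : ℝ) : ∫⁻ p, ENNReal.ofReal (k t p.2 p.1) ∂(γ.prod γ) = gaussianPDF 0 1 t := by
  rw [← lint_k t, ← Measure.prod_swap (μ := γ) (ν := γ), lintegral_map]
  · simp [Measure.prod_swap]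
  · exact (meas_k.comp (by fun_prop : Measurable fun p : ℝ × ℝ => (t, p.2, p.1))).ennreal_ofReal
  · exact measurable_swap

lemma cs_aux {f : ℝ → ℝ} {K : NNReal} (hf : LipschitzWith K f) {x y : ℝ} (h : y ≤ x) :
    ENNReal.ofReal ((f x - f y) ^ 2)
      ≤ ∫⁻ t, ENNReal.ofReal (k t x y) * ENNReal.ofReal (deriv f t ^ 2) := by
  have hb : ∀ t, ‖deriv f t‖ ≤ K := fun t => norm_deriv_le_of_lipschitz hf
  have hm := measurable_deriv f
  have e1 : ∫ t in Ioc y x, deriv f t = f x - f y := by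
    rw [← intervalIntegral.integral_of_le h]
    exact (hf.lipschitzOnWith (s := uIcc y x)).absolutelyContinuousOnInterval.integral_deriv_eq_sub
  have ib : Integrable (deriv f) (volume.restrict (Ioc y x)) :=
    Integrable.of_bound hm.aestronglyMeasurable K (ae_of_all _ hb)
  have ib2 : Integrable (fun t => deriv f t ^ 2) (volume.restrict (Ioc y x)) := by
    refine Integrable.of_bound (hm.pow_const 2).aestronglyMeasurable (K ^ 2) (ae_of_all _ fun t => ?_)
    rw [norm_pow]; gcongr; exact hb t
  have key : (f x - f y) ^ 2 ≤ (x - y) * ∫ t in Ioc y x, deriv f t ^ 2 := by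
    rcases h.eq_or_lt with rfl | hlt
    · simp
    set c := (f x - f y) / (x - y) with hc
    have hpos : 0 < x - y := by linarith
    have h0 : 0 ≤ ∫ t in Ioc y x, (deriv f t - c) ^ 2 := integral_nonneg fun _ => sq_nonneg _
    have h1 : ∫ t in Ioc y x, (deriv f t - c) ^ 2
        = (∫ t in Ioc y x, deriv f t ^ 2) - 2 * c * (f x - f y) + c ^ 2 * (x - y) := by
      have : (fun t => (deriv f t - c) ^ 2) = fun t => (deriv f t ^ 2 - 2 * c * deriv f t) + c ^ 2 := by
        ext t; ring
      have i3 : Integrable (fun t => deriv f t ^ 2 - 2 * c * deriv f t)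
        (volume.restrict (Ioc y x)) := ib2.sub (ib.const_mul _)
      rw [this, integral_add i3 (integrable_const _),
        integral_sub ib2 (ib.const_mul _), integral_const_mul, e1]
      simp [h, mul_comm]
    have hcx : c * (x - y) = f x - f y := by rw [hc]; field_simp
    rw [h1] at h0
    nlinarith [mul_nonneg hpos.le h0]
  calc ENNReal.ofReal ((f x - f y) ^ 2) 
      ≤ ENNReal.ofReal ((x - y) * ∫ t in Ioc y x, deriv f t ^ 2) := ENNReal.ofReal_le_ofReal key
    _ = ENNReal.ofReal (x - y) * ∫⁻ t in Ioc y x, ENNReal.ofReal (deriv f t ^ 2) := by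
        rw [ENNReal.ofReal_mul (by linarith),
          ofReal_integral_eq_lintegral_ofReal ib2 (ae_of_all _ fun _ => sq_nonneg _)]
    _ = ∫⁻ t, ENNReal.ofReal (k t x y) * ENNReal.ofReal (deriv f t ^ 2) := by
        rw [← lintegral_indicator measurableSet_Ioc, ← lintegral_const_mul]
        · congr 1; ext t
          rw [k_eq]
          by_cases ht : y < t ∧ t ≤ x
          · simp [ht, indicator]
          · simp [ht, indicator]
        · exact ((hm.pow_const 2).ennreal_ofReal).indicator measurableSet_Ioc

lemma poincare_one {f : ℝ → ℝ} {K : NNReal} (hf : LipschitzWith K f) (hL : MemLp f 2 γ) :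
    ∫ x, f x ^ 2 ∂γ - (∫ x, f x ∂γ) ^ 2 ≤ ∫ x, deriv f x ^ 2 ∂γ := by
  have hm := measurable_deriv f
  have hb : ∀ t, ‖deriv f t‖ ≤ K := fun t => norm_deriv_le_of_lipschitz hf
  have i1 : Integrable f γ := hL.integrable (by norm_num)
  have i2 : Integrable (fun x => f x ^ 2) γ := hL.integrable_sq
  have ib2 : Integrable (fun t => deriv f t ^ 2) γ := by
    refine Integrable.of_bound (hm.pow_const 2).aestronglyMeasurable (K ^ 2) (ae_of_all _ fun t => ?_)
    rw [norm_pow]; gcongr; exact hb t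
  have j1 : Integrable (fun p : ℝ × ℝ => f p.1 ^ 2) (γ.prod γ) := i2.comp_fst γ
  have j2 : Integrable (fun p : ℝ × ℝ => f p.2 ^ 2) (γ.prod γ) := i2.comp_snd γ
  have j3 : Integrable (fun p : ℝ × ℝ => f p.1 * f p.2) (γ.prod γ) := i1.mul_prod i1
  have e : (fun p : ℝ × ℝ => (f p.1 - f p.2) ^ 2)
      = fun p => (f p.1 ^ 2 + f p.2 ^ 2) - 2 * (f p.1 * f p.2) := by ext p; ring
  have j : Integrable (fun p : ℝ × ℝ => (f p.1 - f p.2) ^ 2) (γ.prod γ) := by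
    rw [e]; exact (j1.add j2).sub (j3.const_mul 2)
  have e2 : ∫ p : ℝ × ℝ, (f p.1 - f p.2) ^ 2 ∂(γ.prod γ)
      = 2 * (∫ x, f x ^ 2 ∂γ - (∫ x, f x ∂γ) ^ 2) := by
    have j12 : Integrable (fun p : ℝ × ℝ => f p.1 ^ 2 + f p.2 ^ 2) (γ.prod γ) := j1.add j2
    rw [e, integral_sub j12 (j3.const_mul 2), integral_add j1 j2, integral_const_mul,
      integral_prod_mul, integral_fun_fst (fun x => f x ^ 2), integral_fun_snd (fun x => f x ^ 2)]
    simp; ring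
  have mk1 : Measurable fun q : (ℝ × ℝ) × ℝ => ENNReal.ofReal (k q.2 q.1.1 q.1.2) :=
    (meas_k.comp (by fun_prop : Measurable fun q : (ℝ × ℝ) × ℝ => (q.2, q.1.1, q.1.2))).ennreal_ofReal
  have mk2 : Measurable fun q : (ℝ × ℝ) × ℝ => ENNReal.ofReal (k q.2 q.1.2 q.1.1) :=
    (meas_k.comp (by fun_prop : Measurable fun q : (ℝ × ℝ) × ℝ => (q.2, q.1.2, q.1.1))).ennreal_ofReal
  have md : Measurable fun t => ENNReal.ofReal (deriv f t ^ 2) := (hm.pow_const 2).ennreal_ofReal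
  have main : ∫⁻ p : ℝ × ℝ, ENNReal.ofReal ((f p.1 - f p.2) ^ 2) ∂(γ.prod γ)
      ≤ 2 * ∫⁻ t, ENNReal.ofReal (deriv f t ^ 2) ∂γ := by
    calc _ ≤ ∫⁻ p : ℝ × ℝ, ∫⁻ t, (ENNReal.ofReal (k t p.1 p.2) + ENNReal.ofReal (k t p.2 p.1))
          * ENNReal.ofReal (deriv f t ^ 2) ∂volume ∂(γ.prod γ) := by
          refine lintegral_mono fun p => ?_
          rcases le_total p.2 p.1 with h | h
          · refine (cs_aux hf h).trans (lintegral_mono fun t => ?_)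
            gcongr; exact le_self_add
          · have := cs_aux hf h
            rw [show (f p.2 - f p.1) ^ 2 = (f p.1 - f p.2) ^ 2 by ring] at this
            refine this.trans (lintegral_mono fun t => ?_)
            gcongr; exact le_add_self
      _ = ∫⁻ t, ∫⁻ p : ℝ × ℝ, (ENNReal.ofReal (k t p.1 p.2) + ENNReal.ofReal (k t p.2 p.1))
          * ENNReal.ofReal (deriv f t ^ 2) ∂(γ.prod γ) := by
          rw [lintegral_lintegral_swap]
          exact ((mk1.add mk2).mul (md.comp measurable_snd)).aemeasurable
      _ = ∫⁻ t, 2 * (gaussianPDF 0 1 t * ENNReal.ofReal (deriv f t ^ 2)) := by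
          congr 1; ext t
          have m1 : Measurable fun p : ℝ × ℝ => ENNReal.ofReal (k t p.1 p.2) :=
            mk1.comp (by fun_prop : Measurable fun p : ℝ × ℝ => (p, t))
          have m2 : Measurable fun p : ℝ × ℝ => ENNReal.ofReal (k t p.2 p.1) :=
            mk2.comp (by fun_prop : Measurable fun p : ℝ × ℝ => (p, t))
          have m12 : Measurable fun p : ℝ × ℝ =>
            ENNReal.ofReal (k t p.1 p.2) + ENNReal.ofReal (k t p.2 p.1) := m1.add m2
          rw [lintegral_mul_const _ m12, lintegral_add_left m1, lint_k, lint_k']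
          ring
      _ = 2 * ∫⁻ t, ENNReal.ofReal (deriv f t ^ 2) ∂γ := by
          have m3 : Measurable fun t => gaussianPDF 0 1 t * ENNReal.ofReal (deriv f t ^ 2) :=
            (measurable_gaussianPDF 0 1).mul md
          rw [lintegral_const_mul _ m3, γ,
            gaussianReal_of_var_ne_zero _ one_ne_zero,
            lintegral_withDensity_eq_lintegral_mul _ (measurable_gaussianPDF 0 1) md]
          rfl
  rw [← ofReal_integral_eq_lintegral_ofReal j (ae_of_all _ fun _ => sq_nonneg _),
    ← ofReal_integral_eq_lintegral_ofReal ib2 (ae_of_all _ fun _ => sq_nonneg _), e2,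
    show (2 : ENNReal) = ENNReal.ofReal 2 by simp, ← ENNReal.ofReal_mul (by norm_num),
    ENNReal.ofReal_le_ofReal_iff] at main
  · linarith
  · exact mul_nonneg (by norm_num) (integral_nonneg fun _ => sq_nonneg _)


lemma efron {α β : Type*} [MeasurableSpace α] [MeasurableSpace β] (μ : Measure α) (ν : Measure β)
    [IsProbabilityMeasure μ] [IsProbabilityMeasure ν] (F : α × β → ℝ)
    (hF : MemLp F 2 (μ.prod ν)) (g : α → ℝ) (h : β → ℝ) (hg : ∀ a, g a = ∫ b, F (a, b) ∂ν)
    (hh : ∀ b, h b = ∫ a, F (a, b) ∂μ) (hgm : MemLp g 2 μ) (hhm : MemLp h 2 ν) :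
    ∫ p, F p ^ 2 ∂(μ.prod ν) - (∫ p, F p ∂(μ.prod ν)) ^ 2
      ≤ ∫ a, (∫ b, F (a, b) ^ 2 ∂ν - (∫ b, F (a, b) ∂ν) ^ 2) ∂μ
        + ∫ b, (∫ a, F (a, b) ^ 2 ∂μ - (∫ a, F (a, b) ∂μ) ^ 2) ∂ν := by
  have F1 : Integrable F (μ.prod ν) := hF.integrable (by norm_num)
  have F2 : Integrable (fun p => F p ^ 2) (μ.prod ν) := hF.integrable_sq
  have g1 : Integrable g μ := hgm.integrable (by norm_num)
  have h1 : Integrable h ν := hhm.integrable (by norm_num)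
  have g2 : Integrable (fun a => g a ^ 2) μ := hgm.integrable_sq
  have h2 : Integrable (fun a => h a ^ 2) ν := hhm.integrable_sq
  have hG : MemLp (fun p : α × β => g p.1) 2 (μ.prod ν) := hgm.comp_measurePreserving measurePreserving_fst
  have hH : MemLp (fun p : α × β => h p.2) 2 (μ.prod ν) := hhm.comp_measurePreserving measurePreserving_snd
  simp only [← hg, ← hh]
  set c := ∫ p, F p ∂(μ.prod ν) with hc
  have cg : ∫ a, g a ∂μ = c := by rw [hc, integral_prod F F1]; simp [hg]
  have ch : ∫ b, h b ∂ν = c := by rw [hc, integral_prod_symm F F1]; simp [hh]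
  have s1 : ∫ a, (∫ b, F (a, b) ^ 2 ∂ν - g a ^ 2) ∂μ
      = ∫ p, F p ^ 2 ∂(μ.prod ν) - ∫ a, g a ^ 2 ∂μ := by
    rw [integral_sub F2.integral_prod_left g2, integral_prod _ F2]
  have s2 : ∫ b, (∫ a, F (a, b) ^ 2 ∂μ - h b ^ 2) ∂ν
      = ∫ p, F p ^ 2 ∂(μ.prod ν) - ∫ a, h a ^ 2 ∂ν := by
    rw [integral_sub F2.integral_prod_right h2, integral_prod_symm _ F2]
  have FG : Integrable (fun p => F p * g p.1) (μ.prod ν) := hF.integrable_mul hG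
  have FH : Integrable (fun p => F p * h p.2) (μ.prod ν) := hF.integrable_mul hH
  have GH : Integrable (fun p : α × β => g p.1 * h p.2) (μ.prod ν) := g1.mul_prod h1
  have GG : Integrable (fun p : α × β => g p.1 ^ 2) (μ.prod ν) := g2.comp_fst ν
  have HH : Integrable (fun p : α × β => h p.2 ^ 2) (μ.prod ν) := h2.comp_snd μ
  have vFG : ∫ p, F p * g p.1 ∂(μ.prod ν) = ∫ a, g a ^ 2 ∂μ := by
    rw [integral_prod _ FG]
    congr 1; ext a
    simp only [integral_mul_const, ← hg]; ring
  have vFH : ∫ p, F p * h p.2 ∂(μ.prod ν) = ∫ a, h a ^ 2 ∂ν := by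
    rw [integral_prod_symm _ FH]
    congr 1; ext a
    simp only [integral_mul_const, ← hh]; ring
  have vGH : ∫ p : α × β, g p.1 * h p.2 ∂(μ.prod ν) = c ^ 2 := by
    rw [integral_prod_mul, cg, ch]; ring
  have vGG : ∫ p : α × β, g p.1 ^ 2 ∂(μ.prod ν) = ∫ a, g a ^ 2 ∂μ := by
    rw [integral_fun_fst (fun a => g a ^ 2)]; simp
  have vHH : ∫ p : α × β, h p.2 ^ 2 ∂(μ.prod ν) = ∫ a, h a ^ 2 ∂ν := by
    rw [integral_fun_snd (fun a => h a ^ 2)]; simp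
  have vG : ∫ p : α × β, g p.1 ∂(μ.prod ν) = c := by
    rw [integral_fun_fst (fun a => g a)]; simp [cg]
  have vH : ∫ p : α × β, h p.2 ∂(μ.prod ν) = c := by
    rw [integral_fun_snd (fun a => h a)]; simp [ch]
  -- variance of `F - g - h` is nonnegative
  have G1 : Integrable (fun p : α × β => g p.1) (μ.prod ν) := g1.comp_fst ν
  have H1 : Integrable (fun p : α × β => h p.2) (μ.prod ν) := h1.comp_snd μ
  have A1 : Integrable (fun p => F p ^ 2 + g p.1 ^ 2) (μ.prod ν) := F2.add GG
  have A2 : Integrable (fun p => F p ^ 2 + g p.1 ^ 2 + h p.2 ^ 2) (μ.prod ν) := A1.add HH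
  have A3 : Integrable (fun p => F p ^ 2 + g p.1 ^ 2 + h p.2 ^ 2 - 2 * (F p * g p.1)) (μ.prod ν) :=
    A2.sub (FG.const_mul 2)
  have A4 : Integrable (fun p => F p ^ 2 + g p.1 ^ 2 + h p.2 ^ 2 - 2 * (F p * g p.1)
      - 2 * (F p * h p.2)) (μ.prod ν) := A3.sub (FH.const_mul 2)
  have A5 : Integrable (fun p => F p ^ 2 + g p.1 ^ 2 + h p.2 ^ 2 - 2 * (F p * g p.1)
      - 2 * (F p * h p.2) + 2 * (g p.1 * h p.2)) (μ.prod ν) := A4.add (GH.const_mul 2)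
  have A6 : Integrable (fun p => F p ^ 2 + g p.1 ^ 2 + h p.2 ^ 2 - 2 * (F p * g p.1)
      - 2 * (F p * h p.2) + 2 * (g p.1 * h p.2) + 2 * c * F p) (μ.prod ν) :=
    A5.add (F1.const_mul _)
  have A7 : Integrable (fun p => F p ^ 2 + g p.1 ^ 2 + h p.2 ^ 2 - 2 * (F p * g p.1)
      - 2 * (F p * h p.2) + 2 * (g p.1 * h p.2) + 2 * c * F p - 2 * c * g p.1) (μ.prod ν) :=
    A6.sub (G1.const_mul _)
  have A8 : Integrable (fun p => F p ^ 2 + g p.1 ^ 2 + h p.2 ^ 2 - 2 * (F p * g p.1)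
      - 2 * (F p * h p.2) + 2 * (g p.1 * h p.2) + 2 * c * F p - 2 * c * g p.1 - 2 * c * h p.2)
      (μ.prod ν) := A7.sub (H1.const_mul _)
  have pos : 0 ≤ ∫ p, (F p - g p.1 - h p.2 + c) ^ 2 ∂(μ.prod ν) :=
    integral_nonneg fun _ => sq_nonneg _
  have e : (fun p => (F p - g p.1 - h p.2 + c) ^ 2) = fun p => F p ^ 2 + g p.1 ^ 2 + h p.2 ^ 2
      - 2 * (F p * g p.1) - 2 * (F p * h p.2) + 2 * (g p.1 * h p.2) + 2 * c * F p
      - 2 * c * g p.1 - 2 * c * h p.2 + c ^ 2 := by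
    ext p; ring
  rw [e, integral_add A8 (integrable_const _), integral_sub A7 (H1.const_mul _),
    integral_sub A6 (G1.const_mul _), integral_add A5 (F1.const_mul _),
    integral_add A4 (GH.const_mul _), integral_sub A3 (FH.const_mul _),
    integral_sub A2 (FG.const_mul _), integral_add A1 HH, integral_add F2 GG] at pos
  simp only [integral_const_mul, vFG, vFH, vGH, vGG, vHH, vG, vH, ← hc] at pos
  simp only [integral_const, probReal_univ, one_smul] at pos
  rw [s1, s2]
  nlinarith [pos]

noncomputable abbrev γn (n : ℕ) : Measure (Fin n → ℝ) := Measure.pi fun _ => γ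

lemma memLp_real {f : ℝ → ℝ} {K : NNReal} (hf : LipschitzWith K f) : MemLp f 2 γ := by
  have h0 : MemLp (fun x : ℝ => ‖x‖) 2 γ :=
    (memLp_id_gaussianReal' (μ := 0) (v := 1) 2 (by simp)).norm
  have h00 : MemLp (fun x : ℝ => (K : ℝ) * ‖x‖) 2 γ := h0.const_mul (K : ℝ)
  have hc : MemLp (fun _ : ℝ => ‖f 0‖) 2 γ := memLp_const ‖f 0‖
  have h1 : MemLp (fun x : ℝ => ‖f 0‖ + (K : ℝ) * ‖x‖) 2 γ := hc.add h00
  refine h1.mono hf.continuous.aestronglyMeasurable (ae_of_all _ fun x => ?_)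
  have := hf.dist_le_mul x 0
  rw [dist_eq_norm, dist_zero_right] at this
  have h2 := norm_add_le (f x - f 0) (f 0)
  rw [sub_add_cancel] at h2
  refine le_trans ?_ (Real.le_norm_self _)
  linarith

lemma memLp_pi {n : ℕ} {f : (Fin n → ℝ) → ℝ} {K : NNReal} (hf : LipschitzWith K f) :
    MemLp f 2 (γn n) := by
  have h0 : MemLp (fun x : Fin n → ℝ => ∑ i, ‖x i‖) 2 (γn n) := by
    refine memLp_finsetSum _ fun i _ => ?_
    have h0 : MemLp (fun x : ℝ => ‖x‖) 2 γ :=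
      (memLp_id_gaussianReal' (μ := 0) (v := 1) 2 (by simp)).norm
    exact h0.comp_measurePreserving
      (measurePreserving_eval (fun _ : Fin n => γ) i)
  have h00 : MemLp (fun x : Fin n → ℝ => (K : ℝ) * ∑ i, ‖x i‖) 2 (γn n) := h0.const_mul (K : ℝ)
  have hc : MemLp (fun _ : Fin n → ℝ => ‖f 0‖) 2 (γn n) := memLp_const ‖f 0‖
  have h1 : MemLp (fun x : Fin n → ℝ => ‖f 0‖ + (K : ℝ) * ∑ i, ‖x i‖) 2 (γn n) := hc.add h00
  refine h1.mono hf.continuous.aestronglyMeasurable (ae_of_all _ fun x => ?_)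
  have := hf.dist_le_mul x 0
  rw [dist_eq_norm, dist_zero_right] at this
  have h2 := norm_add_le (f x - f 0) (f 0)
  rw [sub_add_cancel] at h2
  have h3 : ‖x‖ ≤ ∑ i, ‖x i‖ := by
    refine (pi_norm_le_iff_of_nonneg (Finset.sum_nonneg fun i _ => norm_nonneg _)).2 fun i => ?_
    exact Finset.single_le_sum (f := fun i => ‖x i‖) (fun i _ => norm_nonneg _) (Finset.mem_univ i)
  have h4 : (K : ℝ) * ‖x‖ ≤ K * ∑ i, ‖x i‖ := by gcongr
  refine le_trans ?_ (Real.le_norm_self _)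
  linarith

lemma cons_eq (n : ℕ) : (fun p : ℝ × (Fin n → ℝ) => (Fin.cons p.1 p.2 : Fin (n + 1) → ℝ))
    = (MeasurableEquiv.piFinSuccAbove (fun _ : Fin (n + 1) => ℝ) 0).symm := by
  ext p i
  simp [MeasurableEquiv.piFinSuccAbove]

lemma mp_cons (n : ℕ) : MeasurePreserving
    (fun p : ℝ × (Fin n → ℝ) => (Fin.cons p.1 p.2 : Fin (n + 1) → ℝ)) (γ.prod (γn n)) (γn (n + 1)) := by
  have := (measurePreserving_piFinSuccAbove (fun _ : Fin (n + 1) => γ) 0).symm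
  rw [cons_eq]; exact this

lemma integral_cons (n : ℕ) (f : (Fin (n + 1) → ℝ) → ℝ) :
    ∫ x, f x ∂(γn (n + 1)) = ∫ p, f (Fin.cons p.1 p.2) ∂(γ.prod (γn n)) := by
  have := (measurePreserving_piFinSuccAbove (fun _ : Fin (n + 1) => γ) 0).symm
  refine (this.integral_comp' (g := f)).symm.trans ?_
  rw [← cons_eq]

lemma lip_marg {α E : Type*} [MeasurableSpace α] [PseudoMetricSpace E] {μ : Measure α}
    [IsProbabilityMeasure μ] {F : E → α → ℝ} {K : NNReal}
    (h : ∀ a, LipschitzWith K fun x => F x a) (hi : ∀ x, Integrable (F x) μ) :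
    LipschitzWith K fun x => ∫ a, F x a ∂μ := by
  refine LipschitzWith.of_dist_le_mul fun x y => ?_
  rw [dist_eq_norm, ← integral_sub (hi x) (hi y)]
  refine (norm_integral_le_of_norm_le_const (C := K * dist x y) (ae_of_all _ fun a => ?_)).trans ?_
  · have := (h a).dist_le_mul x y
    rwa [dist_eq_norm] at this
  · simp

lemma lip_cons_right {n : ℕ} {f : (Fin (n + 1) → ℝ) → ℝ} {K : NNReal} (hf : LipschitzWith K f)
    (a : ℝ) : LipschitzWith K fun x : Fin n → ℝ => f (Fin.cons a x) := by
  refine LipschitzWith.of_dist_le_mul fun x y => (hf.dist_le_mul _ _).trans ?_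
  gcongr
  refine (dist_pi_le_iff dist_nonneg).2 fun i => ?_
  refine Fin.cases ?_ (fun i => ?_) i
  · simp
  · simpa using dist_le_pi_dist x y i

lemma lip_cons_left {n : ℕ} {f : (Fin (n + 1) → ℝ) → ℝ} {K : NNReal} (hf : LipschitzWith K f)
    (x : Fin n → ℝ) : LipschitzWith K fun a : ℝ => f (Fin.cons a x) := by
  refine LipschitzWith.of_dist_le_mul fun a b => (hf.dist_le_mul _ _).trans ?_
  gcongr
  refine (dist_pi_le_iff dist_nonneg).2 fun i => ?_
  refine Fin.cases ?_ (fun i => ?_) i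
  · simp
  · simp

lemma deriv_cons {n : ℕ} (f : (Fin (n + 1) → ℝ) → ℝ) (a : ℝ) (x : Fin n → ℝ) :
    deriv (fun a => f (Fin.cons a x)) a = lineDeriv ℝ f (Fin.cons a x) (Pi.single 0 1) := by
  unfold lineDeriv
  have : (fun t : ℝ => f ((Fin.cons a x : Fin (n + 1) → ℝ) + t • (Pi.single 0 1 : Fin (n + 1) → ℝ)))
      = fun t => (fun a => f (Fin.cons a x)) (a + t) := by
    ext t
    dsimp only
    congr 1
    ext i
    refine Fin.cases ?_ (fun i => ?_) i <;> simp
  rw [this, deriv_comp_const_add (fun a => f (Fin.cons a x)), add_zero]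

lemma lineDeriv_cons {n : ℕ} (f : (Fin (n + 1) → ℝ) → ℝ) (a : ℝ) (x : Fin n → ℝ) (i : Fin n) :
    lineDeriv ℝ (fun x : Fin n → ℝ => f (Fin.cons a x)) x (Pi.single i 1)
      = lineDeriv ℝ f (Fin.cons a x) (Pi.single i.succ 1) := by
  unfold lineDeriv
  refine congrArg (fun φ : ℝ → ℝ => deriv φ 0) (funext fun t => congrArg f (funext fun j => ?_))
  refine Fin.cases ?_ (fun j => ?_) j
  · simp
  · by_cases h : j = i
    · subst h; simp
    · simp [h]

lemma int_lineDeriv {n : ℕ} {f : (Fin n → ℝ) → ℝ} {K : NNReal} (hf : LipschitzWith K f)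
    (v : Fin n → ℝ) : Integrable (fun x => lineDeriv ℝ f x v ^ 2) (γn n) := by
  refine Integrable.of_bound
    ((measurable_lineDeriv hf.continuous).pow_const 2).aestronglyMeasurable
    ((K * ‖v‖) ^ 2) (ae_of_all _ fun t => ?_)
  rw [norm_pow]; gcongr
  exact norm_lineDeriv_le_of_lipschitz ℝ hf

lemma poincare_pi {K : NNReal} : ∀ (n : ℕ) (f : (Fin n → ℝ) → ℝ) (_ : LipschitzWith K f),
    ∫ x, f x ^ 2 ∂(γn n) - (∫ x, f x ∂(γn n)) ^ 2
      ≤ ∫ x, ∑ i, lineDeriv ℝ f x (Pi.single i 1) ^ 2 ∂(γn n) := by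
  intro n
  induction n with
  | zero =>
    intro f hf
    have h : ∀ x, f x = f 0 := fun x => by rw [Subsingleton.elim x 0]
    simp [h]
  | succ n ih =>
    intro f hf
    have hF : MemLp (fun p : ℝ × (Fin n → ℝ) => f (Fin.cons p.1 p.2)) 2 (γ.prod (γn n)) :=
      (memLp_pi hf).comp_measurePreserving (mp_cons n)
    have E := efron γ (γn n) (fun p => f (Fin.cons p.1 p.2)) hF
      (fun a => ∫ x, f (Fin.cons a x) ∂(γn n)) (fun x => ∫ a, f (Fin.cons a x) ∂γ)
      (fun _ => rfl) (fun _ => rfl)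
      (memLp_real (lip_marg (fun x => lip_cons_left hf x)
        fun a => (memLp_pi (lip_cons_right hf a)).integrable (by norm_num)))
      (memLp_pi (lip_marg (F := fun x a => f (Fin.cons a x)) (fun a => lip_cons_right hf a)
        fun x => (memLp_real (lip_cons_left hf x)).integrable (by norm_num)))
    rw [integral_cons n, integral_cons n]
    refine E.trans ?_
    have hF2 := hF.integrable_sq
    have D : ∀ i, Integrable (fun p : ℝ × (Fin n → ℝ) =>
        lineDeriv ℝ f (Fin.cons p.1 p.2) (Pi.single i 1) ^ 2) (γ.prod (γn n)) := fun i =>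
      (mp_cons n).integrable_comp_of_integrable (int_lineDeriv hf (Pi.single i 1))
    have Ds : Integrable (fun p : ℝ × (Fin n → ℝ) =>
        ∑ i : Fin n, lineDeriv ℝ f (Fin.cons p.1 p.2) (Pi.single i.succ 1) ^ 2) (γ.prod (γn n)) :=
      integrable_finsetSum _ fun i _ => D i.succ
    have R : ∫ x, ∑ i, lineDeriv ℝ f x (Pi.single i 1) ^ 2 ∂(γn (n + 1))
        = ∫ a, ∫ x, ∑ i : Fin n, lineDeriv ℝ f (Fin.cons a x) (Pi.single i.succ 1) ^ 2 ∂(γn n) ∂γ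
          + ∫ x, ∫ a, lineDeriv ℝ f (Fin.cons a x) (Pi.single 0 1) ^ 2 ∂γ ∂(γn n) := by
      rw [integral_cons n]
      simp only [Fin.sum_univ_succ]
      rw [integral_add (D 0) Ds, integral_prod _ Ds, integral_prod_symm _ (D 0), add_comm]
    rw [R]
    refine add_le_add ?_ ?_
    · refine integral_mono_of_nonneg (ae_of_all _ fun a => ?_) Ds.integral_prod_left
        (ae_of_all _ fun a => ?_)
      · have := variance_nonneg (fun x => f (Fin.cons a x)) (γn n)
        rw [variance_eq_sub (memLp_pi (lip_cons_right hf a))] at this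
        simpa using this
      · have := ih _ (lip_cons_right hf a)
        simp only [lineDeriv_cons] at this
        exact this
    · refine integral_mono_of_nonneg (ae_of_all _ fun x => ?_) (D 0).integral_prod_right
        (ae_of_all _ fun x => ?_)
      · have := variance_nonneg (fun a => f (Fin.cons a x)) γ
        rw [variance_eq_sub (memLp_real (lip_cons_left hf x))] at this
        simpa using this
      · have := poincare_one (lip_cons_left hf x) (memLp_real (lip_cons_left hf x))
        simp only [deriv_cons] at this
        exact this

lemma ac_pi (n : ℕ) : γn n ≪ volume := by
  induction n with
  | zero => 
    refine Measure.AbsolutelyContinuous.mk fun s _ h => ?_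
    rw [volume_pi, Measure.pi_of_empty] at h
    rw [γn, Measure.pi_of_empty]
    exact h
  | succ n ih =>
    have h1 := (mp_cons n).map_eq
    have h2 := (volume_preserving_piFinSuccAbove (fun _ : Fin (n + 1) => ℝ) 0).symm
    have h3 : (γ.prod (γn n)) ≪ (volume : Measure (ℝ × (Fin n → ℝ))) :=
      (gaussianReal_absolutelyContinuous 0 one_ne_zero).prod ih
    rw [← h1, ← h2.map_eq, cons_eq]
    exact h3.map h2.measurable

lemma grad_bound {d : ℕ} {f : EuclideanSpace ℝ (Fin d) → ℝ} {L : NNReal} (hf : LipschitzWith L f)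
    (x : Fin d → ℝ) (hx : DifferentiableAt ℝ (fun x => f ((EuclideanSpace.equiv (Fin d) ℝ).symm x)) x) :
    ∑ i, lineDeriv ℝ (fun x => f ((EuclideanSpace.equiv (Fin d) ℝ).symm x)) x (Pi.single i 1) ^ 2
      ≤ (L : ℝ) ^ 2 := by
  set e := EuclideanSpace.equiv (Fin d) ℝ
  set g := fun x => f (e.symm x)
  set D := fderiv ℝ g x with hD
  have hfd : HasFDerivAt f (D ∘L (e : EuclideanSpace ℝ (Fin d) →L[ℝ] (Fin d → ℝ))) (e.symm x) := by
    have h1 : HasFDerivAt g D (e (e.symm x)) := by simpa using hx.hasFDerivAt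
    have := h1.comp (e.symm x) e.hasFDerivAt
    have h2 : g ∘ e = f := by ext y; simp [g]
    rwa [h2] at this
  have hn : ‖D ∘L (e : EuclideanSpace ℝ (Fin d) →L[ℝ] (Fin d → ℝ))‖ ≤ L := by
    rw [← hfd.fderiv]; exact norm_fderiv_le_of_lipschitz ℝ hf
  have hl : ∀ i, lineDeriv ℝ g x (Pi.single i 1) = D (Pi.single i 1) := fun i =>
    hx.lineDeriv_eq_fderiv
  simp only [hl]
  set v : Fin d → ℝ := fun i => D (Pi.single i 1) with hv
  have h1 : D v = ∑ i, v i ^ 2 := by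
    conv_lhs => rw [← Finset.univ_sum_single v]
    rw [map_sum]
    refine Finset.sum_congr rfl fun i _ => ?_
    have : (Pi.single i (v i) : Fin d → ℝ) = v i • Pi.single i 1 := by
      rw [← Pi.single_smul]; simp
    rw [this, map_smul, smul_eq_mul, sq]
  have h2 : ‖D v‖ ≤ L * ‖e.symm v‖ := by
    have := (D ∘L (e : EuclideanSpace ℝ (Fin d) →L[ℝ] (Fin d → ℝ))).le_of_opNorm_le hn (e.symm v)
    simpa using this
  have h3 : ‖e.symm v‖ ^ 2 = ∑ i, v i ^ 2 := by
    rw [EuclideanSpace.norm_sq_eq]; simp [e]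
  change ∑ i, v i ^ 2 ≤ _
  rw [h1, ← h3] at h2
  rw [← h3]
  rw [Real.norm_of_nonneg (by positivity)] at h2
  have h4 : ‖e.symm v‖ ≤ L := by
    by_contra! hlt
    have : (0:ℝ) ≤ L := L.2
    nlinarith
  gcongr


lemma poincare_std (d : ℕ) (f : EuclideanSpace ℝ (Fin d) → ℝ) (L : NNReal)
    (hf : LipschitzWith L f) :
    IsProbabilityMeasure (_root_.stdGaussian d) ∧ MemLp f 2 (_root_.stdGaussian d) ∧
    ∫ ω, (f ω - ∫ ω', f ω' ∂(_root_.stdGaussian d)) ^ 2 ∂(_root_.stdGaussian d) ≤ (L : ℝ) ^ 2 := by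
  set e := EuclideanSpace.equiv (Fin d) ℝ with he
  have hem : Measurable e.symm := e.symm.continuous.measurable
  have hmp : MeasurePreserving e.symm (γn d) (_root_.stdGaussian d) := ⟨hem, rfl⟩
  have hprob : IsProbabilityMeasure (_root_.stdGaussian d) := by
    rw [← hmp.map_eq]; exact Measure.isProbabilityMeasure_map hem.aemeasurable
  have hg : LipschitzWith (L * ‖(e.symm : (Fin d → ℝ) →L[ℝ] EuclideanSpace ℝ (Fin d))‖₊)
      (fun x => f (e.symm x)) :=
    hf.comp (e.symm : (Fin d → ℝ) →L[ℝ] EuclideanSpace ℝ (Fin d)).lipschitz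
  have hLp := memLp_pi hg
  have hLf : MemLp f 2 (_root_.stdGaussian d) := by
    have : MemLp (f ∘ e.symm) 2 (γn d) := hLp
    rw [← hmp.map_eq]
    exact (memLp_map_measure_iff hf.continuous.aestronglyMeasurable hem.aemeasurable).2 this
  refine ⟨hprob, hLf, ?_⟩
  have hv := variance_eq_integral (X := f) (μ := _root_.stdGaussian d) hf.continuous.aemeasurable
  rw [← hv, variance_eq_sub hLf, ← hmp.map_eq]
  simp only [Pi.pow_apply]
  have hc2 : Continuous fun x => f x ^ 2 := hf.continuous.pow 2
  rw [integral_map hem.aemeasurable hc2.aestronglyMeasurable,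
    integral_map hem.aemeasurable hf.continuous.aestronglyMeasurable]
  refine (poincare_pi d _ hg).trans ?_
  have hae : ∀ᵐ x ∂(γn d), DifferentiableAt ℝ (fun x => f (e.symm x)) x :=
    (ac_pi d).ae_le hg.ae_differentiableAt
  calc _ ≤ ∫ x, (L : ℝ) ^ 2 ∂(γn d) := by
        refine integral_mono_of_nonneg
          (ae_of_all _ fun x => Finset.sum_nonneg fun i _ => sq_nonneg _) (integrable_const _) ?_
        filter_upwards [hae] with x hx
        exact grad_bound hf x hx
    _ = (L : ℝ) ^ 2 := by simp

lemma mean_sq {α : Type*} [MeasurableSpace α] (μ : Measure α) [IsProbabilityMeasure μ]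
    (f : α → ℝ) (hf : MemLp f 2 μ) (m : ℕ) (hm : 0 < m) :
    ∫ w, ((∫ ω, f ω ∂μ) - (1 / m : ℝ) * ∑ j, f (w j)) ^ 2 ∂(Measure.pi fun _ : Fin m => μ)
      = (∫ ω, (f ω - ∫ ω', f ω' ∂μ) ^ 2 ∂μ) / m := by
  have hm' : (m : ℝ) ≠ 0 := by positivity
  have h1 := variance_sum_pi (μ := fun _ : Fin m => μ) (X := fun _ => f) (fun _ => hf)
  have hj : ∀ j : Fin m, MemLp (fun w : Fin m → α => f (w j)) 2 (Measure.pi fun _ : Fin m => μ) :=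
    fun j => hf.comp_measurePreserving (measurePreserving_eval (fun _ : Fin m => μ) j)
  have hS : MemLp (∑ j : Fin m, fun w : Fin m → α => f (w j)) 2 (Measure.pi fun _ : Fin m => μ) :=
    memLp_finsetSum' _ fun j _ => hj j
  have hE : ∫ w, (∑ j : Fin m, fun w : Fin m → α => f (w j)) w ∂(Measure.pi fun _ : Fin m => μ)
      = m * ∫ ω, f ω ∂μ := by
    simp only [Finset.sum_apply]
    rw [integral_finsetSum _ fun j _ => (hj j).integrable (by norm_num)]
    have : ∀ j : Fin m, ∫ w : Fin m → α, f (w j) ∂(Measure.pi fun _ : Fin m => μ) = ∫ ω, f ω ∂μ := by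
      intro j
      have mp := measurePreserving_eval (fun _ : Fin m => μ) j
      have := integral_map mp.measurable.aemeasurable (f := f) (by rw [mp.map_eq]; exact hf.1)
      rw [mp.map_eq] at this
      exact this.symm
    simp [this]
  rw [variance_eq_integral hS.1.aemeasurable, hE] at h1
  simp only [variance_eq_integral hf.1.aemeasurable, Finset.sum_const, Finset.card_univ,
    Fintype.card_fin, nsmul_eq_mul] at h1
  have e : ∀ w : Fin m → α, ((∫ ω, f ω ∂μ) - (1 / m : ℝ) * ∑ j, f (w j)) ^ 2
      = (1 / m : ℝ) ^ 2 * ((∑ j : Fin m, fun w : Fin m → α => f (w j)) w - m * ∫ ω, f ω ∂μ) ^ 2 := by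
    intro w
    simp only [Finset.sum_apply]
    field_simp
    ring
  simp only [e]
  rw [integral_const_mul, h1]
  field_simp

end GP

/-- Gaussian Poincaré inequality: an `L`-Lipschitz function of a standard
Gaussian vector has variance at most `L²`; consequently the empirical mean of
`m` i.i.d. samples has mean squared deviation `Var(f(ω))/m ≤ L²/m`. -/
theorem gaussian_poincare_variance_bound
    (d m : ℕ) (hm : 0 < m)
    (f : EuclideanSpace ℝ (Fin d) → ℝ) (L : NNReal)
    (hf : LipschitzWith L f) :
    (∫ ω, (f ω - ∫ ω', f ω' ∂(stdGaussian d)) ^ 2 ∂(stdGaussian d)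
        ≤ (L : ℝ) ^ 2) ∧
    (∫ w, ((∫ ω, f ω ∂(stdGaussian d)) - (1 / m : ℝ) * ∑ j, f (w j)) ^ 2
        ∂(Measure.pi fun _ : Fin m => stdGaussian d)
      = (∫ ω, (f ω - ∫ ω', f ω' ∂(stdGaussian d)) ^ 2 ∂(stdGaussian d)) / m) ∧
    (∫ w, ((∫ ω, f ω ∂(stdGaussian d)) - (1 / m : ℝ) * ∑ j, f (w j)) ^ 2
        ∂(Measure.pi fun _ : Fin m => stdGaussian d)
      ≤ (L : ℝ) ^ 2 / m) := by
  obtain ⟨hp, hL, hV⟩ := GP.poincare_std d f L hf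
  have h2 := GP.mean_sq (_root_.stdGaussian d) f hL m hm
  refine ⟨hV, h2, ?_⟩
  rw [h2]
  gcongr
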